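/- arXiv:2010.03513 — 3 statements merged into one kernel-verified Lean document; each statement's English description precedes it below -/
import Mathlib

section
/- Self-concordance of the multi-category log-partition function (Lemma A.2). For any v = (v₁,…,v_{m−1})ᵀ ∈ ℝ^{m−1} and w = (w₁,…,w_{m−1})ᵀ ∈ ℝ^{m−1}, the function η : ℝ → ℝ defined by η(t) = log(1 + Σ_{j=1}^{m−1} e^{w_j + t v_j}) satisfies |η'''(t)| ≤ 4‖v‖₂ η''(t) for every t ∈ ℝ. -/
section ExpMoment

variable {ι : Type*} [Fintype ι]

/-- The `k`-th moment of `v` under the unnormalized weights `e^{w_j + s v_j}`. -/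
noncomputable def expMoment (v w : ι → ℝ) (k : ℕ) (s : ℝ) : ℝ :=
  ∑ j, v j ^ k * Real.exp (w j + s * v j)

theorem expMoment_zero_nonneg (v w : ι → ℝ) (s : ℝ) : 0 ≤ expMoment v w 0 s :=
  Finset.sum_nonneg fun j _ => by positivity

theorem one_add_expMoment_zero_pos (v w : ι → ℝ) (s : ℝ) : 0 < 1 + expMoment v w 0 s := by
  linarith [expMoment_zero_nonneg v w s]

theorem hasDerivAt_expMoment (v w : ι → ℝ) (k : ℕ) (s : ℝ) :
    HasDerivAt (expMoment v w k) (expMoment v w (k + 1) s) s := by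
  unfold expMoment
  refine HasDerivAt.fun_sum fun j _ => ?_
  have h := ((((hasDerivAt_id s).mul_const (v j)).const_add (w j)).exp).const_mul (v j ^ k)
  exact h.congr_deriv (by simp only [id]; ring)

theorem hasDerivAt_log_one_add_expMoment (v w : ι → ℝ) (s : ℝ) :
    HasDerivAt (fun s => Real.log (1 + expMoment v w 0 s))
      (expMoment v w 1 s / (1 + expMoment v w 0 s)) s :=
  ((hasDerivAt_expMoment v w 0 s).const_add 1).log (one_add_expMoment_zero_pos v w s).ne'

theorem hasDerivAt_expMoment_div (v w : ι → ℝ) (k : ℕ) (s : ℝ) :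
    HasDerivAt (fun s => expMoment v w k s / (1 + expMoment v w 0 s))
      (expMoment v w (k + 1) s / (1 + expMoment v w 0 s) -
        expMoment v w k s / (1 + expMoment v w 0 s) *
          (expMoment v w 1 s / (1 + expMoment v w 0 s))) s := by
  have hZ := (one_add_expMoment_zero_pos v w s).ne'
  refine ((hasDerivAt_expMoment v w k s).fun_div
    ((hasDerivAt_expMoment v w 0 s).const_add 1) hZ).congr_deriv ?_
  field_simp

theorem abs_expMoment_one_div_le {v : ι → ℝ} {V : ℝ} (hV : 0 ≤ V) (hv : ∀ j, |v j| ≤ V)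
    (w : ι → ℝ) (s : ℝ) : |expMoment v w 1 s / (1 + expMoment v w 0 s)| ≤ V := by
  have hZ := one_add_expMoment_zero_pos v w s
  rw [abs_div, abs_of_pos hZ, div_le_iff₀ hZ]
  have h : |expMoment v w 1 s| ≤ V * expMoment v w 0 s := by
    unfold expMoment
    rw [Finset.mul_sum]
    refine (Finset.abs_sum_le_sum_abs _ _).trans (Finset.sum_le_sum fun j _ => ?_)
    rw [abs_mul, Real.abs_exp, pow_one, pow_zero, one_mul]
    exact mul_le_mul_of_nonneg_right (hv j) (Real.exp_pos _).le
  linarith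

theorem sum_exp_mul_sub_sq (v w : ι → ℝ) (μ s : ℝ) :
    ∑ j, Real.exp (w j + s * v j) * (v j - μ) ^ 2 =
      expMoment v w 2 s - 2 * μ * expMoment v w 1 s + μ ^ 2 * expMoment v w 0 s := by
  simp only [expMoment, Finset.mul_sum, ← Finset.sum_add_distrib, ← Finset.sum_sub_distrib]
  exact Finset.sum_congr rfl fun j _ => by ring

theorem sum_exp_mul_sub_cube (v w : ι → ℝ) (μ s : ℝ) :
    ∑ j, Real.exp (w j + s * v j) * (v j - μ) ^ 3 =
      expMoment v w 3 s - 3 * μ * expMoment v w 2 s + 3 * μ ^ 2 * expMoment v w 1 s -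
        μ ^ 3 * expMoment v w 0 s := by
  simp only [expMoment, Finset.mul_sum, ← Finset.sum_add_distrib, ← Finset.sum_sub_distrib]
  exact Finset.sum_congr rfl fun j _ => by ring

theorem abs_cube_le_mul_sq {x V : ℝ} (h : |x| ≤ V) : |x ^ 3| ≤ V * x ^ 2 := by
  rw [abs_pow, pow_succ', sq_abs]
  exact mul_le_mul_of_nonneg_right h (sq_nonneg x)

/-- The third central moment is dominated by the range times the variance. -/
theorem abs_third_central_moment_le {v : ι → ℝ} {V μ : ℝ} (hμ : |μ| ≤ V)
    (hv : ∀ j, |v j| ≤ V) (w : ι → ℝ) (s : ℝ) :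
    |-μ ^ 3 + ∑ j, Real.exp (w j + s * v j) * (v j - μ) ^ 3| ≤
      2 * V * (μ ^ 2 + ∑ j, Real.exp (w j + s * v j) * (v j - μ) ^ 2) := by
  have hV : 0 ≤ V := (abs_nonneg μ).trans hμ
  refine (abs_add_le _ _).trans ?_
  rw [mul_add, Finset.mul_sum, abs_neg]
  refine add_le_add (abs_cube_le_mul_sq (by linarith))
    ((Finset.abs_sum_le_sum_abs _ _).trans (Finset.sum_le_sum fun j _ => ?_))
  have hj : |v j - μ| ≤ 2 * V := (abs_sub _ _).trans (by linarith [hv j])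
  rw [abs_mul, Real.abs_exp, mul_left_comm]
  exact mul_le_mul_of_nonneg_left (abs_cube_le_mul_sq hj) (Real.exp_pos _).le

end ExpMoment

/-- Self-concordance of the multi-category log-partition function along a line:
for `η(t) = log(1 + ∑_j e^{w_j + t v_j})`, one has `|η'''(t)| ≤ 4‖v‖₂ η''(t)`. -/
theorem stmt_5 (m : ℕ) (hm : 2 ≤ m) (v w : Fin (m - 1) → ℝ) (t : ℝ) :
    |deriv (deriv (deriv fun s : ℝ => Real.log (1 + ∑ j, Real.exp (w j + s * v j)))) t| ≤
      4 * Real.sqrt (∑ j, v j ^ 2) *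
        deriv (deriv fun s : ℝ => Real.log (1 + ∑ j, Real.exp (w j + s * v j))) t := by
  have h0 : (fun s : ℝ => Real.log (1 + ∑ j, Real.exp (w j + s * v j))) =
      fun s => Real.log (1 + expMoment v w 0 s) := by simp [expMoment]
  rw [h0, funext fun s => (hasDerivAt_log_one_add_expMoment v w s).deriv,
    funext fun s => (hasDerivAt_expMoment_div v w 1 s).deriv,
    ((hasDerivAt_expMoment_div v w 2 t).fun_sub
      ((hasDerivAt_expMoment_div v w 1 t).fun_mul (hasDerivAt_expMoment_div v w 1 t))).deriv]
  set V := Real.sqrt (∑ j, v j ^ 2)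
  have hV : 0 ≤ V := Real.sqrt_nonneg _
  have hv : ∀ j, |v j| ≤ V := fun j => Real.abs_le_sqrt
    (Finset.single_le_sum (f := fun j => v j ^ 2) (fun i _ => sq_nonneg _) (Finset.mem_univ j))
  have hμ := abs_expMoment_one_div_le hV hv w t
  have hZ := one_add_expMoment_zero_pos v w t
  have key := abs_third_central_moment_le hμ hv w t
  have hvar : 0 ≤ (expMoment v w 1 t / (1 + expMoment v w 0 t)) ^ 2 + ∑ j,
      Real.exp (w j + t * v j) * (v j - expMoment v w 1 t / (1 + expMoment v w 0 t)) ^ 2 := by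
    positivity
  rw [sum_exp_mul_sub_sq] at hvar
  rw [sum_exp_mul_sub_sq, sum_exp_mul_sub_cube] at key
  have key' := key.trans (mul_le_mul_of_nonneg_right (by linarith : 2 * V ≤ 4 * V) hvar)
  refine le_of_mul_le_mul_left ?_ hZ
  rw [← abs_of_pos hZ, ← abs_mul, abs_of_pos hZ, mul_left_comm]
  beta_reduce
  have hzero : expMoment v w 0 t = (1 + expMoment v w 0 t) - 1 := by ring
  generalize 1 + expMoment v w 0 t = Z at hZ hzero key' ⊢
  rw [hzero] at key'
  refine Eq.trans_le (congrArg _ ?_) (key'.trans_eq (congrArg _ ?_))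
  · field_simp
    ring
  · field_simp
    ring
end

section
/- Pointwise Taylor bounds for the multi-category log-partition function. Let b(θ) = log(1 + Σ_{ℓ=1}^{m−1} e^{θ_ℓ}) for θ ∈ ℝ^{m−1}. For θ₀ ∈ ℝ^{m−1}, let μ₀ ∈ ℝ^{m−1} be given by μ_{0ℓ} = e^{θ_{0ℓ}}/(1 + Σ_k e^{θ_{0k}}) and W₀ = diag(μ₀) − μ₀μ₀ᵀ (so μ₀ = ∇b(θ₀) and W₀ = ∇²b(θ₀)). Then for every θ ∈ ℝ^{m−1}: (θ−θ₀)ᵀ W₀ (θ−θ₀) / (2 + 4‖θ−θ₀‖₂) ≤ b(θ) − b(θ₀) − μ₀ᵀ(θ−θ₀) ≤ (1/2)‖θ−θ₀‖₂². -/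
open Matrix

open MeasureTheory ProbabilityTheory in
/-- **Hoeffding's lemma** for a finitely supported random variable with values in `[-R, R]`. -/
theorem log_sum_mul_exp_sub_mean_le {ι : Type*} [Fintype ι] {p x : ι → ℝ} {R : ℝ}
    (hp : ∀ i, 0 ≤ p i) (hp1 : ∑ i, p i = 1) (hx : ∀ i, |x i| ≤ R) :
    Real.log (∑ i, p i * Real.exp (x i)) - ∑ i, p i * x i ≤ 1 / 2 * R ^ 2 := by
  let _ : MeasurableSpace ι := ⊤
  let ν : Measure ι := ∑ i, ENNReal.ofReal (p i) • Measure.dirac i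
  have hν : IsProbabilityMeasure ν := ⟨by
    simp only [ν, Measure.coe_finsetSum, Finset.sum_apply, Measure.smul_apply, measure_univ,
      smul_eq_mul, mul_one]
    rw [← ENNReal.ofReal_sum_of_nonneg fun i _ => hp i, hp1, ENNReal.ofReal_one]⟩
  have hint (f : ι → ℝ) : ∫ i, f i ∂ν = ∑ i, p i * f i := by
    have (i : ι) : IsFiniteMeasure (ENNReal.ofReal (p i) • Measure.dirac i) :=
      Measure.smul_finite _ ENNReal.ofReal_ne_top
    rw [integral_finsetSum_measure fun i _ => .of_finite]
    refine Finset.sum_congr rfl fun i _ => ?_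
    rw [integral_smul_measure, integral_dirac, ENNReal.toReal_ofReal (hp i), smul_eq_mul]
  have h := (hasSubgaussianMGF_of_mem_Icc (μ := ν) (X := x) (a := -R) (b := R)
    (measurable_of_finite x).aemeasurable (.of_forall fun i => abs_le.1 (hx i))).mgf_le 1
  simp only [mgf, one_mul, hint, Real.exp_sub, one_pow, mul_one, ← mul_div_assoc,
    ← Finset.sum_div] at h
  have hR : ((‖R - -R‖₊ / 2 : NNReal) ^ 2 : NNReal) = R ^ 2 := by
    push_cast
    rw [Real.norm_eq_abs, div_pow, sq_abs]
    ring
  rw [div_le_iff₀ (Real.exp_pos _), ← Real.exp_add, hR] at h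
  have hpos : 0 < ∑ i, p i * Real.exp (x i) := by
    refine (Finset.sum_nonneg fun i _ => mul_nonneg (hp i) (Real.exp_pos _).le).lt_of_ne' ?_
    intro h0
    rw [Finset.sum_eq_zero_iff_of_nonneg
      fun i _ => mul_nonneg (hp i) (Real.exp_pos _).le] at h0
    have : ∑ i, p i = 0 := Finset.sum_eq_zero fun i hi =>
      (mul_eq_zero.1 (h0 i hi)).resolve_right (Real.exp_ne_zero _)
    linarith
  have := Real.log_le_log hpos h
  rw [Real.log_exp] at this
  linarith

theorem one_add_add_sq_div_le_exp {y r : ℝ} (h : |y| ≤ r) :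
    1 + y + y ^ 2 / (2 + r) ≤ Real.exp y := by
  have hr : 0 ≤ r := (abs_nonneg y).trans h
  rcases le_total 0 y with hy | hy
  · refine le_trans ?_ (Real.quadratic_le_exp_of_nonneg hy)
    gcongr
    linarith
  · obtain ⟨z, rfl⟩ : ∃ z, y = -z := ⟨-y, by ring⟩
    have hz : 0 ≤ z := by linarith
    have hzr : z ≤ r := by rwa [abs_neg, abs_of_nonneg hz] at h
    have h1 : 1 + -z + (-z) ^ 2 / (2 + r) ≤ (2 - z) / (2 + z) := by
      have : (-z) ^ 2 / (2 + r) ≤ (-z) ^ 2 / (2 + z) := by gcongr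
      refine (add_le_add_right this _).trans (le_of_eq ?_)
      field_simp
      ring
    refine h1.trans ?_
    rcases le_or_gt 2 z with h2 | h2
    · exact (div_nonpos_of_nonpos_of_nonneg (by linarith) (by linarith)).trans
        (Real.exp_pos _).le
    · have h3 : 0 < 2 - z := by linarith
      have h4 := Real.le_log_one_add_of_nonneg (x := 2 * z / (2 - z)) (by positivity)
      have e1 : 2 * (2 * z / (2 - z)) / (2 * z / (2 - z) + 2) = z := by
        field_simp
        ring
      have e2 : 1 + 2 * z / (2 - z) = ((2 - z) / (2 + z))⁻¹ := by
        field_simp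
        ring
      rw [e1, e2, Real.log_inv] at h4
      rw [← Real.log_le_iff_le_exp (by positivity)]
      linarith

theorem variance_div_le_log_sum_mul_exp_sub_mean {ι : Type*} [Fintype ι] {p x : ι → ℝ} {R : ℝ}
    (hR : 0 ≤ R) (hp : ∀ i, 0 ≤ p i) (hp1 : ∑ i, p i = 1) (hx : ∀ i, |x i| ≤ R) :
    (∑ i, p i * x i ^ 2 - (∑ i, p i * x i) ^ 2) / (2 + 4 * R) ≤
      Real.log (∑ i, p i * Real.exp (x i)) - ∑ i, p i * x i := by
  set M := ∑ i, p i * x i with hM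
  set V := ∑ i, p i * x i ^ 2 - M ^ 2 with hV
  set s := 1 + R / 2 with hs
  have hs1 : 1 ≤ s := by linarith
  have hs0 : 0 < s := by linarith
  have hMR : |M| ≤ R := by
    refine (Finset.abs_sum_le_sum_abs _ _).trans ?_
    calc ∑ i, |p i * x i| ≤ ∑ i, p i * R := by
          refine Finset.sum_le_sum fun i _ => ?_
          rw [abs_mul, abs_of_nonneg (hp i)]
          exact mul_le_mul_of_nonneg_left (hx i) (hp i)
      _ = R := by rw [← Finset.sum_mul, hp1, one_mul]
  have hmean : ∑ i, p i * (x i - M) = 0 := by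
    simp only [mul_sub, Finset.sum_sub_distrib, ← Finset.sum_mul, hp1, ← hM]
    ring
  have hvar : ∑ i, p i * (x i - M) ^ 2 = V := by
    have (i : ι) : p i * (x i - M) ^ 2 = p i * x i ^ 2 - 2 * M * (p i * x i) + p i * M ^ 2 := by
      ring
    simp only [this, Finset.sum_add_distrib, Finset.sum_sub_distrib, ← Finset.mul_sum,
      ← Finset.sum_mul, hp1, ← hM, hV]
    ring
  have hV0 : 0 ≤ V := hvar ▸ Finset.sum_nonneg fun i _ => mul_nonneg (hp i) (sq_nonneg _)
  have hVR : V ≤ R ^ 2 := by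
    have : ∑ i, p i * x i ^ 2 ≤ ∑ i, p i * R ^ 2 := Finset.sum_le_sum fun i _ =>
      mul_le_mul_of_nonneg_left (sq_le_sq' (abs_le.1 (hx i)).1 (abs_le.1 (hx i)).2) (hp i)
    rw [← Finset.sum_mul, hp1, one_mul] at this
    nlinarith [sq_nonneg M]
  set q := V / (s * (2 * s + 2 * R)) with hq
  have hq0 : 0 ≤ q := by positivity
  set A := ∑ i, p i * Real.exp ((x i - M) / s) with hA
  have hqA : 1 + q ≤ A := by
    have h (i : ι) : p i * (1 + (x i - M) / s + ((x i - M) / s) ^ 2 / (2 + 2 * R / s)) ≤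
        p i * Real.exp ((x i - M) / s) := by
      refine mul_le_mul_of_nonneg_left (one_add_add_sq_div_le_exp ?_) (hp i)
      rw [abs_div, abs_of_pos hs0]
      gcongr
      have := abs_sub (x i) M
      linarith [hx i]
    refine le_trans (le_of_eq ?_) (Finset.sum_le_sum fun i _ => h i)
    have (i : ι) : p i * (1 + (x i - M) / s + ((x i - M) / s) ^ 2 / (2 + 2 * R / s)) =
        p i + p i * (x i - M) / s + p i * (x i - M) ^ 2 / (s * (2 * s + 2 * R)) := by
      field_simp
    simp only [this, Finset.sum_add_distrib, ← Finset.sum_div, hp1, hmean, hvar, hq]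
    ring
  have hA0 : 0 < A := by linarith
  have hpow : A ^ s ≤ Real.exp (-M) * ∑ i, p i * Real.exp (x i) := by
    have h := Real.rpow_arith_mean_le_arith_mean_rpow Finset.univ p
      (fun i => Real.exp ((x i - M) / s)) (fun i _ => hp i) hp1
      (fun i _ => (Real.exp_pos _).le) hs1
    refine h.trans (le_of_eq ?_)
    rw [Finset.mul_sum]
    refine Finset.sum_congr rfl fun i _ => ?_
    rw [← Real.exp_mul, div_mul_cancel₀ _ hs0.ne', sub_eq_add_neg, Real.exp_add]
    ring
  have hE : ∑ i, p i * Real.exp (x i) ≠ 0 := by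
    intro h0
    rw [h0, mul_zero] at hpow
    exact (Real.rpow_pos_of_pos hA0 s).not_ge hpow
  have hlog := Real.log_le_log (Real.rpow_pos_of_pos hA0 s) hpow
  rw [Real.log_rpow hA0, Real.log_mul (Real.exp_ne_zero _) hE, Real.log_exp] at hlog
  have hlogA : 2 * q / (q + 2) ≤ Real.log A :=
    (Real.le_log_one_add_of_nonneg hq0).trans (Real.log_le_log (by linarith) hqA)
  have hfin : V / (2 + 4 * R) ≤ s * (2 * q / (q + 2)) := by
    have e : s * (2 * q / (q + 2)) = V * (2 * s) / (V + 2 * (s * (2 * s + 2 * R))) := by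
      rw [hq]
      field_simp
    rw [e, div_le_div_iff₀ (by positivity) (by positivity), mul_assoc]
    refine mul_le_mul_of_nonneg_left ?_ hV0
    rw [hs]
    nlinarith
  have := mul_le_mul_of_nonneg_left hlogA hs0.le
  linarith

/-- Pointwise Taylor bounds for the multi-category log-partition function
`b(θ) = log(1 + ∑_ℓ e^{θ_ℓ})`: with `μ₀ = ∇b(θ₀)` and `W₀ = ∇²b(θ₀) = diag(μ₀) − μ₀μ₀ᵀ`,
`(θ−θ₀)ᵀW₀(θ−θ₀)/(2 + 4‖θ−θ₀‖₂) ≤ b(θ) − b(θ₀) − μ₀ᵀ(θ−θ₀) ≤ (1/2)‖θ−θ₀‖₂²`. -/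
theorem stmt_9 (m : ℕ) (hm : 2 ≤ m) (θ θ₀ : Fin (m - 1) → ℝ)
    (μ₀ : Fin (m - 1) → ℝ)
    (hμ₀ : μ₀ = fun ℓ => Real.exp (θ₀ ℓ) / (1 + ∑ k, Real.exp (θ₀ k)))
    (W₀ : Matrix (Fin (m - 1)) (Fin (m - 1)) ℝ)
    (hW₀ : W₀ = Matrix.of fun i j => (if i = j then μ₀ i else 0) - μ₀ i * μ₀ j) :
    ((θ - θ₀) ⬝ᵥ W₀.mulVec (θ - θ₀)) /
        (2 + 4 * Real.sqrt (∑ ℓ, (θ ℓ - θ₀ ℓ) ^ 2)) ≤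
      Real.log (1 + ∑ ℓ, Real.exp (θ ℓ)) - Real.log (1 + ∑ ℓ, Real.exp (θ₀ ℓ)) -
        ∑ ℓ, μ₀ ℓ * (θ ℓ - θ₀ ℓ) ∧
    Real.log (1 + ∑ ℓ, Real.exp (θ ℓ)) - Real.log (1 + ∑ ℓ, Real.exp (θ₀ ℓ)) -
        ∑ ℓ, μ₀ ℓ * (θ ℓ - θ₀ ℓ) ≤
      (1 / 2) * ∑ ℓ, (θ ℓ - θ₀ ℓ) ^ 2 := by
  set S := 1 + ∑ k, Real.exp (θ₀ k) with hS
  have hS0 : 0 < S := add_pos_of_pos_of_nonneg one_pos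
    (Finset.sum_nonneg fun i _ => (Real.exp_pos _).le)
  have hT0 : 0 < 1 + ∑ k, Real.exp (θ k) := add_pos_of_pos_of_nonneg one_pos
    (Finset.sum_nonneg fun i _ => (Real.exp_pos _).le)
  set R := Real.sqrt (∑ ℓ, (θ ℓ - θ₀ ℓ) ^ 2) with hR
  have hR2 : ∑ ℓ, (θ ℓ - θ₀ ℓ) ^ 2 = R ^ 2 :=
    (Real.sq_sqrt (Finset.sum_nonneg fun i _ => sq_nonneg _)).symm
  have hμ (i : Fin (m - 1)) : μ₀ i = Real.exp (θ₀ i) / S := congrFun hμ₀ i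
  let p : Option (Fin (m - 1)) → ℝ := fun o => o.elim (1 / S) μ₀
  let x : Option (Fin (m - 1)) → ℝ := fun o => o.elim 0 (θ - θ₀)
  have hp : ∀ o, 0 ≤ p o := by
    rintro (_ | i)
    · exact (one_div_pos.2 hS0).le
    · exact (div_pos (Real.exp_pos _) hS0).le.trans_eq (hμ i).symm
  have hp1 : ∑ o, p o = 1 := by
    simp only [p, Fintype.sum_option, Option.elim, hμ]
    rw [← Finset.sum_div, ← add_div, ← hS, div_self hS0.ne']
  have hx : ∀ o, |x o| ≤ R := by
    rintro (_ | i)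
    · exact abs_zero.trans_le (Real.sqrt_nonneg _)
    · refine Real.abs_le_sqrt ?_
      exact Finset.single_le_sum (f := fun ℓ => (θ ℓ - θ₀ ℓ) ^ 2) (fun _ _ => sq_nonneg _)
        (Finset.mem_univ i)
  have hmean : ∑ o, p o * x o = ∑ ℓ, μ₀ ℓ * (θ ℓ - θ₀ ℓ) := by
    simp [p, x, Fintype.sum_option]
  have hvar : ∑ o, p o * x o ^ 2 - (∑ o, p o * x o) ^ 2 =
      (θ - θ₀) ⬝ᵥ W₀.mulVec (θ - θ₀) := by
    have hW : W₀ = Matrix.diagonal μ₀ - Matrix.vecMulVec μ₀ μ₀ := by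
      ext i j
      simp [hW₀, Matrix.diagonal_apply, Matrix.vecMulVec_apply]
    rw [hmean, hW, Matrix.sub_mulVec, Matrix.vecMulVec_mulVec, dotProduct_sub, sq]
    congr 1
    · simp only [p, x, Fintype.sum_option, Option.elim, dotProduct, Matrix.mulVec_diagonal]
      rw [zero_pow two_ne_zero, mul_zero, zero_add]
      exact Finset.sum_congr rfl fun i _ => by ring
    · rw [dotProduct_smul, dotProduct_comm (θ - θ₀)]
      simp [dotProduct]
  have hmgf : Real.log (∑ o, p o * Real.exp (x o)) =
      Real.log (1 + ∑ ℓ, Real.exp (θ ℓ)) - Real.log S := by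
    rw [← Real.log_div hT0.ne' hS0.ne']
    congr 1
    simp only [p, x, Fintype.sum_option, Option.elim, hμ, Real.exp_zero, mul_one, add_div,
      Finset.sum_div, Pi.sub_apply, Real.exp_sub]
    congr 1
    refine Finset.sum_congr rfl fun i _ => ?_
    field_simp
  rw [← hvar, ← hmgf, ← hmean, hR2]
  exact ⟨variance_div_le_log_sum_mul_exp_sub_mean (Real.sqrt_nonneg _) hp hp1 hx,
    log_sum_mul_exp_sub_mean_le hp hp1 hx⟩
end

section
/- Quadratic-penalty maximization inequality (used in the proof of Theorem 1): for any real numbers x > 0, A > 0, B > 0, C > 0 and δ ∈ (0,1) such that AC ≤ (1−δ)B, it holds that Ax − Bx²/(2 + Cx) ≤ 2A²/((1−δ)B). -/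
/-- Quadratic-penalty maximization inequality: for `x > 0`, `A,B,C > 0`, `δ ∈ (0,1)`
with `A·C ≤ (1-δ)·B`, one has `A·x - B·x²/(2 + C·x) ≤ 2A²/((1-δ)B)`. -/
theorem stmt_12 (x A B C δ : ℝ) (hx : 0 < x) (hA : 0 < A) (hB : 0 < B) (hC : 0 < C)
    (hδ : δ ∈ Set.Ioo (0 : ℝ) 1) (h : A * C ≤ (1 - δ) * B) :
    A * x - B * x ^ 2 / (2 + C * x) ≤ 2 * A ^ 2 / ((1 - δ) * B) := by
  obtain ⟨hδ0, hδ1⟩ := hδ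
  have hK : 0 < (1 - δ) * B := mul_pos (by linarith) hB
  have hD : 0 < 2 + C * x := by positivity
  have hKB : (1 - δ) * B ≤ B := by nlinarith
  have hp : 0 < A * C := mul_pos hA hC
  generalize (1 - δ) * B = K at *
  have hprod : (K - A * C) * (K - A * C) ≤ (B - A * C) * K :=
    mul_le_mul (by linarith) (by linarith) (by linarith) (by linarith)
  have hsq := mul_le_mul_of_nonneg_right hprod (sq_nonneg x)
  rw [sub_le_iff_le_add, div_add_div _ _ hK.ne' hD.ne', le_div_iff₀ (mul_pos hK hD)]
  linarith [sq_nonneg ((K - A * C) * x - A), sq_nonneg A]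
end
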